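/- Let Σ be a set of identities and V = Mod(Σ). Assume V is minimal: some member of V has more than one element, and for every set of identities Σ' with Σ ⊆ Σ', either every model of Σ' has at most one element, or every member of V satisfies every identity of Σ'. If every member of V is abelian, then either every member of V is affine, or every member of V is strongly abelian. -/

import Mathlib

namespace UA

/-- An algebraic language: a type of operation symbols with arities. -/
structure Lang where
  F : Type
  arity : F → ℕ

variable {L : Lang}

/-- An interpretation of the language `L` on the carrier `A` (an algebra structure). -/
def Interp (L : Lang) (A : Type) : Type :=
  (f : L.F) → ((Fin (L.arity f)) → A) → A

/-- Terms of the language `L` over a type `X` of variables. -/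
inductive Term (L : Lang) (X : Type) : Type
  | var : X → Term L X
  | app : (f : L.F) → ((Fin (L.arity f)) → Term L X) → Term L X

/-- Realization of a term under an assignment of the variables. -/
def Term.realize {A X : Type} (I : Interp L A) (v : X → A) : Term L X → A
  | .var x => v x
  | .app f ts => I f (fun i => (ts i).realize I v)

/-- Relabelling (substitution of variables) of terms. -/
def Term.relabel {X Y : Type} (g : X → Y) : Term L X → Term L Y
  | .var x => .var (g x)
  | .app f ts => .app f (fun i => (ts i).relabel g)

/-- `p` is a polynomial operation of the algebra `(A, I)` with argument-index type `X`:
it is the realization of a term in variables `X ⊕ Fin m` where the `Fin m` variables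
are evaluated at fixed constants. -/
def IsPolyOp {A X : Type} (I : Interp L A) (p : (X → A) → A) : Prop :=
  ∃ (m : ℕ) (t : Term L (X ⊕ Fin m)) (c : Fin m → A),
    ∀ x : X → A, p x = t.realize I (Sum.elim x c)

/-- A unary polynomial operation. -/
def IsUnaryPolyOp {A : Type} (I : Interp L A) (g : A → A) : Prop :=
  IsPolyOp I (fun x : Fin 1 → A => g (x 0))

/-- `(p, q, r, s)` is a `1,1`-matrix of the algebra `(A, I)`. -/
def Is11Matrix {A : Type} (I : Interp L A) (p q r s : A) : Prop :=
  ∃ (k l : ℕ) (t : ((Fin k ⊕ Fin l) → A) → A), IsPolyOp I t ∧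
    ∃ (a b : Fin k → A) (u v : Fin l → A),
      p = t (Sum.elim a u) ∧ q = t (Sum.elim a v) ∧
      r = t (Sum.elim b u) ∧ s = t (Sum.elim b v)

/-- The algebra is abelian: in every `1,1`-matrix, `p = q` implies `r = s`. -/
def IsAbelian {A : Type} (I : Interp L A) : Prop :=
  ∀ p q r s : A, Is11Matrix I p q r s → p = q → r = s

/-- The algebra is strongly rectangular: in every `1,1`-matrix, `q = r` implies `r = s`. -/
def IsStronglyRectangular {A : Type} (I : Interp L A) : Prop :=
  ∀ p q r s : A, Is11Matrix I p q r s → q = r → r = s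

/-- Strongly abelian = abelian + strongly rectangular. -/
def IsStronglyAbelian {A : Type} (I : Interp L A) : Prop :=
  IsAbelian I ∧ IsStronglyRectangular I

/-- The algebra has a Maltsev polynomial operation. -/
def HasMaltsevPoly {A : Type} (I : Interp L A) : Prop :=
  ∃ mOp : (Fin 3 → A) → A, IsPolyOp I mOp ∧
    ∀ x y : A, mOp ![x, y, y] = x ∧ mOp ![y, y, x] = x

/-- Affine = abelian + has a Maltsev polynomial operation. -/
def IsAffine {A : Type} (I : Interp L A) : Prop :=
  IsAbelian I ∧ HasMaltsevPoly I

/-- The algebra satisfies the identity `e.1 ≈ e.2`. -/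
def Satisfies {A : Type} (I : Interp L A) (e : Term L ℕ × Term L ℕ) : Prop :=
  ∀ v : ℕ → A, e.1.realize I v = e.2.realize I v

/-- Membership in the variety `Mod(E)` axiomatized by the set `E` of identities. -/
def InVariety {A : Type} (E : Set (Term L ℕ × Term L ℕ)) (I : Interp L A) : Prop :=
  ∀ e ∈ E, Satisfies I e

/-- `θ` is a congruence on the algebra `(A, I)`. -/
def IsCong {A : Type} (I : Interp L A) (θ : A → A → Prop) : Prop :=
  Equivalence θ ∧
    ∀ (f : L.F) (a b : Fin (L.arity f) → A),
      (∀ i, θ (a i) (b i)) → θ (I f a) (I f b)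

/-- `(p, q, r, s)` is a `θ`-matrix of the algebra `(A, I)`. -/
def IsThetaMatrix {A : Type} (I : Interp L A) (θ : A → A → Prop) (p q r s : A) : Prop :=
  ∃ (k l : ℕ) (t : ((Fin k ⊕ Fin l) → A) → A), IsPolyOp I t ∧
    ∃ (a b : Fin k → A) (u v : Fin l → A),
      (∀ i, θ (a i) (b i)) ∧ (∀ j, θ (u j) (v j)) ∧
      p = t (Sum.elim a u) ∧ q = t (Sum.elim a v) ∧
      r = t (Sum.elim b u) ∧ s = t (Sum.elim b v)

/-- `θ` is a strongly abelian congruence. -/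
def IsStronglyAbelianCong {A : Type} (I : Interp L A) (θ : A → A → Prop) : Prop :=
  ∀ p q r s : A, IsThetaMatrix I θ p q r s → (p = q → r = s) ∧ (q = r → r = s)

/-- `S` is a subuniverse of the algebra `(A, I)`. -/
def IsSubuniverse {A : Type} (I : Interp L A) (S : Set A) : Prop :=
  ∀ (f : L.F) (a : Fin (L.arity f) → A), (∀ i, a i ∈ S) → I f a ∈ S

/-- The substructure (restricted algebra structure) on a subuniverse. -/
def subInterp {A : Type} (I : Interp L A) (S : Set A) (hS : IsSubuniverse I S) :
    Interp L S :=
  fun f a => ⟨I f (fun i => (a i : A)), hS f _ (fun i => (a i).2)⟩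

/-- The componentwise algebra structure on a product. -/
def prodInterp {ι : Type} {A : ι → Type} (I : ∀ i, Interp L (A i)) :
    Interp L (∀ i, A i) :=
  fun f a i => I i f (fun j => a j i)

/-- The componentwise algebra structure on `A × A`. -/
def pairInterp {A : Type} (I : Interp L A) : Interp L (A × A) :=
  fun f a => (I f (fun i => (a i).1), I f (fun i => (a i).2))

/-- `h` is a homomorphism of `L`-algebras. -/
def IsHom {A B : Type} (I : Interp L A) (J : Interp L B) (h : A → B) : Prop :=
  ∀ (f : L.F) (a : Fin (L.arity f) → A), h (I f a) = J f (fun i => h (a i))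

/-- The induced algebra structure on the quotient by a congruence `ρ`
(well-defined, i.e. independent of the chosen representatives, when `ρ` is a congruence). -/
noncomputable def quotInterp {A : Type} (I : Interp L A) (ρ : A → A → Prop) :
    Interp L (Quot ρ) :=
  fun f a => Quot.mk ρ (I f (fun i => (a i).out))

/-- The subuniverse generated by a subset `G`: the intersection of all
subuniverses containing `G`. -/
def GenSub {A : Type} (I : Interp L A) (G : Set A) : Set A :=
  {x | ∀ S : Set A, IsSubuniverse I S → G ⊆ S → x ∈ S}

theorem genSub_isSubuniverse {A : Type} (I : Interp L A) (G : Set A) :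
    IsSubuniverse I (GenSub I G) :=
  fun f a ha S hS hG => hS f a (fun i => ha i S hS hG)

/-- The smallest congruence containing the pair `(x, y)`: the intersection of all
congruences containing it. -/
def genCong {A : Type} (I : Interp L A) (x y : A) : A → A → Prop :=
  fun w z => ∀ ρ : A → A → Prop, IsCong I ρ → ρ x y → ρ w z

/-- The carrier of `A(θ)`, the graph of `θ` inside `A × A`. -/
abbrev ThetaSub {A : Type} (θ : A → A → Prop) : Type := {z : A × A // θ z.1 z.2}

/-- The substructure `A(θ) ≤ A × A` supported by the graph of `θ`. -/
def thetaSubInterp {A : Type} (I : Interp L A) (θ : A → A → Prop) (hθ : IsCong I θ) :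
    Interp L (ThetaSub θ) :=
  fun f a => ⟨(I f (fun i => (a i).1.1), I f (fun i => (a i).1.2)),
    hθ.2 f _ _ (fun i => (a i).2)⟩

/-- The diagonal element `(c, c)` of `A(θ)`. -/
def diagEl {A : Type} {θ : A → A → Prop} (hrefl : ∀ a : A, θ a a) (c : A) :
    ThetaSub θ := ⟨(c, c), hrefl c⟩

/-- `Δ`: the smallest congruence of `A(θ)` containing `D × D`, where `D` is the
diagonal -- the intersection of all congruences of `A(θ)` containing `D × D`. -/
def DeltaRel {A : Type} (I : Interp L A) (θ : A → A → Prop) (hθ : IsCong I θ) :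
    ThetaSub θ → ThetaSub θ → Prop :=
  fun x y => ∀ ρ : ThetaSub θ → ThetaSub θ → Prop,
    IsCong (thetaSubInterp I θ hθ) ρ →
    (∀ c d : A, ρ (diagEl hθ.1.refl c) (diagEl hθ.1.refl d)) → ρ x y

/-- The quotient algebra `S = A(θ)/Δ`. -/
noncomputable def SInterp {A : Type} (I : Interp L A) (θ : A → A → Prop)
    (hθ : IsCong I θ) : Interp L (Quot (DeltaRel I θ hθ)) :=
  quotInterp (thetaSubInterp I θ hθ) (DeltaRel I θ hθ)

/-- The element `0` of `S = A(θ)/Δ`: the `Δ`-class of a diagonal element. -/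
def zeroS {A : Type} (I : Interp L A) (θ : A → A → Prop) (hθ : IsCong I θ) (d : A) :
    Quot (DeltaRel I θ hθ) :=
  Quot.mk _ (diagEl hθ.1.refl d)

/-- The diagonal of `B × B`. -/
def diagSet (B : Type) : Set (B × B) := {z | z.1 = z.2}

/-- The set of pairs `(u j, v j)`. -/
def pairsSet {B : Type} {l : ℕ} (u v : Fin l → B) : Set (B × B) :=
  {z | ∃ j, z = (u j, v j)}

/-- The carrier of the subalgebra `C ≤ B × B` generated by the diagonal and the
pairs `(u j, v j)`. -/
def CsetOf {L : Lang} {B : Type} (I : Interp L B) {l : ℕ} (u v : Fin l → B) :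
    Set (B × B) :=
  GenSub (pairInterp I) (diagSet B ∪ pairsSet u v)

/-- The subalgebra `C ≤ B × B` generated by the diagonal and the pairs `(u j, v j)`. -/
def CInterpOf {L : Lang} {B : Type} (I : Interp L B) {l : ℕ} (u v : Fin l → B) :
    Interp L (CsetOf I u v) :=
  subInterp (pairInterp I) _ (genSub_isSubuniverse _ _)

section Terms

variable {A B X Y : Type}

theorem Term.realize_hom {I : Interp L A} {J : Interp L B} {h : A → B} (hh : IsHom I J h)
    (v : X → A) (t : Term L X) : h (t.realize I v) = t.realize J (fun x => h (v x)) := by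
  induction t with
  | var x => rfl
  | app f ts ih => simp only [Term.realize, hh f, ih]

/-- The algebra of terms over the variables `X`. -/
def termInterp (L : Lang) (X : Type) : Interp L (Term L X) := Term.app

/-- Simultaneous substitution of terms for variables. -/
def Term.subst (σ : X → Term L Y) (t : Term L X) : Term L Y := t.realize (termInterp L Y) σ

theorem isHom_realize (I : Interp L A) (v : X → A) :
    IsHom (termInterp L X) I (fun t => t.realize I v) := fun _ _ => rfl

theorem Term.realize_subst (I : Interp L A) (σ : X → Term L Y) (v : Y → A) (t : Term L X) :
    (t.subst σ).realize I v = t.realize I (fun x => (σ x).realize I v) :=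
  Term.realize_hom (isHom_realize I v) σ t

theorem Term.realize_relabel (I : Interp L A) (g : X → Y) (v : Y → A) (t : Term L X) :
    (t.relabel g).realize I v = t.realize I (fun x => v (g x)) := by
  induction t with
  | var x => rfl
  | app f ts ih => simp only [Term.relabel, Term.realize, ih]

theorem Term.exists_relabel_fin (t : Term L X) :
    ∃ (n : ℕ) (s : Term L (Fin n)) (g : Fin n → X), t = s.relabel g := by
  suffices h : ∃ (F : Type) (_ : Fintype F) (s : Term L F) (g : F → X), t = s.relabel g by
    obtain ⟨F, _, s, g, rfl⟩ := h
    have hrel : ∀ r : Term L F, r.relabel g =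
        (r.relabel (Fintype.equivFin F)).relabel (fun i => g ((Fintype.equivFin F).symm i)) := by
      intro r
      induction r with
      | var x => simp [Term.relabel]
      | app f ts ih => simp only [Term.relabel, ← ih]
    exact ⟨_, _, _, hrel s⟩
  have hcomp : ∀ {F G H : Type} (r : Term L F) (a : F → G) (b : G → H),
      (r.relabel a).relabel b = r.relabel (fun x => b (a x)) := by
    intro F G H r a b
    induction r with
    | var x => rfl
    | app f ts ih => simp only [Term.relabel, ih]
  induction t with
  | var x => exact ⟨Unit, inferInstance, .var (), fun _ => x, rfl⟩
  | app f ts ih =>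
    choose F hF s g hs using ih
    refine ⟨Σ i, F i, inferInstance, .app f (fun i => (s i).relabel (fun x => ⟨i, x⟩)),
      fun x => g x.1 x.2, ?_⟩
    simp only [Term.relabel, hcomp]
    exact congrArg (Term.app f) (funext hs)

/-- Substitution of `a` for the distinguished variable of a context. -/
def plug (p : Term L (Option X)) (a : Term L X) : Term L X :=
  p.subst (fun o => o.elim a Term.var)

theorem realize_plug (I : Interp L A) (p : Term L (Option X)) (a : Term L X) (v : X → A) :
    (plug p a).realize I v = p.realize I (fun o => o.elim (a.realize I v) v) := by
  rw [plug, Term.realize_subst]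
  congr 1
  funext o
  cases o <;> rfl

end Terms

section Matrices

variable {A X : Type} {I : Interp L A}

/-- The subalgebra of `A ^ 4` generated by the quadruples `(p, p, r, r)` and `(p, q, p, q)`. -/
inductive Mat (I : Interp L A) : A → A → A → A → Prop
  | row (p r : A) : Mat I p p r r
  | col (p q : A) : Mat I p q p q
  | app (f : L.F) (p q r s : Fin (L.arity f) → A) (h : ∀ i, Mat I (p i) (q i) (r i) (s i)) :
      Mat I (I f p) (I f q) (I f r) (I f s)

theorem Mat.realize (t : Term L X) {p q r s : X → A} (h : ∀ x, Mat I (p x) (q x) (r x) (s x)) :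
    Mat I (t.realize I p) (t.realize I q) (t.realize I r) (t.realize I s) := by
  induction t with
  | var x => exact h x
  | app f ts ih => exact Mat.app f _ _ _ _ ih

theorem Mat.exists_term {p q r s : A} (h : Mat I p q r s) :
    ∃ t : Term L (A × A ⊕ A × A),
      p = t.realize I (Sum.elim Prod.fst Prod.fst) ∧ q = t.realize I (Sum.elim Prod.fst Prod.snd) ∧
      r = t.realize I (Sum.elim Prod.snd Prod.fst) ∧
      s = t.realize I (Sum.elim Prod.snd Prod.snd) := by
  induction h with
  | row p r => exact ⟨.var (.inl (p, r)), rfl, rfl, rfl, rfl⟩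
  | col p q => exact ⟨.var (.inr (p, q)), rfl, rfl, rfl, rfl⟩
  | app f p q r s _ ih =>
    choose t hp hq hr hs using ih
    refine ⟨.app f t, ?_, ?_, ?_, ?_⟩ <;> simp only [Term.realize] <;> congr 1 <;> funext i
    exacts [hp i, hq i, hr i, hs i]

theorem Mat.is11Matrix {p q r s : A} (h : Mat I p q r s) : Is11Matrix I p q r s := by
  obtain ⟨t, rfl, rfl, rfl, rfl⟩ := h.exists_term
  obtain ⟨n, t, g, rfl⟩ := t.exists_relabel_fin
  let e : Fin n → Fin n ⊕ Fin n := fun i => (g i).elim (fun _ => .inl i) (fun _ => .inr i)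
  have key : ∀ α β : A × A → A,
      (t.relabel g).realize I (Sum.elim α β) = (t.relabel e).realize I
        (Sum.elim (fun i => α ((g i).elim id id)) (fun i => β ((g i).elim id id))) := by
    intro α β
    rw [Term.realize_relabel, Term.realize_relabel]
    congr 1
    funext i
    simp only [e]
    rcases hg : g i <;> simp [hg]
  refine ⟨n, n, fun x => (t.relabel e).realize I x,
    ⟨0, (t.relabel e).relabel Sum.inl, Fin.elim0, fun x => ?_⟩,
    _, _, _, _, key _ _, key _ _, key _ _, key _ _⟩
  rw [Term.realize_relabel (g := Sum.inl)]
  rfl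

theorem Mat.flip {p q r s : A} (h : Mat I p q r s) : Mat I r s p q := by
  induction h with
  | row p r => exact .row r p
  | col p q => exact .col p q
  | app f p q r s _ ih => exact .app f _ _ _ _ ih

theorem Mat.const (p : A) : Mat I p p p p := .row p p

theorem IsAbelian.iff (hI : IsAbelian I) {p q r s : A} (h : Mat I p q r s) : p = q ↔ r = s :=
  ⟨hI p q r s h.is11Matrix, hI r s p q h.flip.is11Matrix⟩

end Matrices

section Varieties

variable {X : Type} {E : Set (Term L ℕ × Term L ℕ)}

/-- The identity `s ≈ t` holds in the variety axiomatized by `E`. -/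
def Valid (E : Set (Term L ℕ × Term L ℕ)) (s t : Term L X) : Prop :=
  ∀ (A : Type) (I : Interp L A), InVariety E I → ∀ v : X → A, s.realize I v = t.realize I v

/-- The syntactic congruence of a set of terms. -/
def syntacticSetoid (O : Set (Term L X)) : Setoid (Term L X) where
  r a b := ∀ p : Term L (Option X), plug p a ∈ O ↔ plug p b ∈ O
  iseqv := ⟨fun _ _ => Iff.rfl, fun h p => (h p).symm, fun h h' p => (h p).trans (h' p)⟩

theorem syntacticSetoid_update (O : Set (Term L X)) (f : L.F) (c : Fin (L.arity f) → Term L X)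
    (i : Fin (L.arity f)) {a b : Term L X} (h : syntacticSetoid O a b) :
    syntacticSetoid O (.app f (Function.update c i a)) (.app f (Function.update c i b)) := by
  intro p
  let q : Term L (Option X) := p.subst (fun o => o.elim
    (.app f (Function.update (fun j => (c j).relabel some) i (.var none))) (fun x => .var (some x)))
  have hq : ∀ d : Term L X, plug p (.app f (Function.update c i d)) = plug q d := by
    intro d
    have := Term.realize_subst (termInterp L X) (fun o : Option X => o.elim
      (.app f (Function.update (fun j => (c j).relabel some) i (.var none)))
      (fun x => Term.var (some x))) (fun o => o.elim d Term.var) p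
    rw [plug, plug, Term.subst, Term.subst]
    refine Eq.trans ?_ this.symm
    congr 1
    funext o
    cases o with
    | some x => rfl
    | none =>
      have hvar : ∀ e : Term L X, e.realize (termInterp L X) Term.var = e := by
        intro e
        induction e with
        | var x => rfl
        | app f ts ih => simp only [Term.realize, ih]; rfl
      change Term.app f _ = Term.app f _
      congr 1
      funext j
      by_cases hj : j = i
      · subst hj; simp [Term.realize]
      · simp [Function.update_of_ne hj, Term.realize_relabel, hvar]
  rw [hq, hq]
  exact h q

theorem syntacticSetoid_app (O : Set (Term L X)) (f : L.F) (a b : Fin (L.arity f) → Term L X)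
    (h : ∀ i, syntacticSetoid O (a i) (b i)) : syntacticSetoid O (.app f a) (.app f b) := by
  classical
  suffices ∀ S : Finset (Fin (L.arity f)),
      syntacticSetoid O (.app f a) (.app f (fun i => if i ∈ S then b i else a i)) by
    simpa using this Finset.univ
  intro S
  induction S using Finset.induction_on with
  | empty => simp
  | insert i S hi ih =>
    refine (syntacticSetoid O).trans ih ?_
    have := syntacticSetoid_update O f (fun j => if j ∈ S then b j else a j) i (h i)
    convert this using 2
    · funext j
      by_cases hj : j = i
      · subst hj; simp [hi]
      · simp [hj]
    · funext j
      by_cases hj : j = i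
      · subst hj; simp
      · simp [hj]

/-- The quotient of the term algebra by the syntactic congruence of a set of terms
that is closed under the identities of the variety belongs to the variety. -/
theorem exists_syntactic_quotient (O : Set (Term L X))
    (hO : ∀ s t : Term L X, Valid E s t → s ∈ O → t ∈ O) :
    ∃ (Q : Type) (J : Interp L Q) (π : Term L X → Q), InVariety E J ∧ Function.Surjective π ∧
      IsHom (termInterp L X) J π ∧
      ∀ a b, π a = π b ↔ ∀ p : Term L (Option X), plug p a ∈ O ↔ plug p b ∈ O := by
  let π : Term L X → Quotient (syntacticSetoid O) := fun a => Quotient.mk _ a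
  let J : Interp L (Quotient (syntacticSetoid O)) := fun f a => π (.app f (fun i => (a i).out))
  have hπ : Function.Surjective π := Quotient.mk_surjective
  have hJ : IsHom (termInterp L X) J π := fun f a =>
    Quotient.sound (syntacticSetoid_app O f _ _ fun i =>
      (syntacticSetoid O).symm (Quotient.mk_out (a i)))
  refine ⟨_, J, π, ?_, hπ, hJ, fun a b => Quotient.eq⟩
  intro e he v
  obtain ⟨σ, rfl⟩ : ∃ σ : ℕ → Term L X, v = fun n => π (σ n) :=
    ⟨fun n => (hπ (v n)).choose, funext fun n => (hπ (v n)).choose_spec.symm⟩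
  rw [← Term.realize_hom hJ, ← Term.realize_hom hJ]
  refine Quotient.sound fun p => ?_
  have hval : Valid E (plug p (e.1.subst σ)) (plug p (e.2.subst σ)) := by
    intro A I hI w
    rw [realize_plug, realize_plug, Term.realize_subst, Term.realize_subst, hI e he]
  exact ⟨hO _ _ hval, hO _ _ fun A I hI w => (hval A I hI w).symm⟩

/-- If a nontrivial member of a minimal variety satisfies a family of identities, then
every member does. -/
theorem valid_of_nontrivial_model
    (hminimal : ∀ E' : Set (Term L ℕ × Term L ℕ), E ⊆ E' →
      (∀ (A : Type) (I : Interp L A), InVariety E' I → ∀ x y : A, x = y) ∨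
      (∀ (A : Type) (I : Interp L A), InVariety E I → InVariety E' I))
    (Φ : ∀ X : Type, Term L X → Term L X → Prop) {B : Type} {J : Interp L B}
    (hJ : InVariety E J) {x y : B} (hxy : x ≠ y)
    (hΦ : ∀ (X : Type) (s t : Term L X), Φ X s t → ∀ v, s.realize J v = t.realize J v)
    {X : Type} [Countable X] {s t : Term L X} (hst : Φ X s t) : Valid E s t := by
  have : Encodable X := Encodable.ofCountable X
  let E' : Set (Term L ℕ × Term L ℕ) := E ∪ {e | ∃ (X : Type) (s t : Term L X) (ι : X → ℕ),
    Φ X s t ∧ e = (s.relabel ι, t.relabel ι)}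
  rcases hminimal E' Set.subset_union_left with h | h
  · refine absurd (h B J ?_ x y) hxy
    rintro e (he | ⟨X, s, t, ι, hst, rfl⟩) v
    · exact hJ e he v
    · simp only [Term.realize_relabel]
      exact hΦ X s t hst _
  · intro A I hI v
    have := h A I hI (s.relabel Encodable.encode, t.relabel Encodable.encode)
      (Or.inr ⟨X, s, t, _, hst, rfl⟩)
      (fun n => ((Encodable.decode n : Option X).map v).getD (s.realize I v))
    simpa [Term.realize_relabel] using this

end Varieties

section Contexts

variable {A B K M W X Y : Type} {I : Interp L A} {E : Set (Term L ℕ × Term L ℕ)}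

/-- The value of a context at `z`, with the remaining variables evaluated by `v`. -/
def fill (I : Interp L A) (p : Term L (Option X)) (z : A) (v : X → A) : A :=
  p.realize I (fun o => o.elim z v)

theorem realize_plug_eq_fill (p : Term L (Option X)) (a : Term L X) (v : X → A) :
    (plug p a).realize I v = fill I p (a.realize I v) v := realize_plug I p a v

theorem realize_subst_option (p : Term L (Option X)) (a : Term L Y) (τ : X → Term L Y)
    (v : Y → A) : (p.subst (fun o => o.elim a τ)).realize I v =
      fill I p (a.realize I v) (fun x => (τ x).realize I v) := by
  rw [Term.realize_subst, fill]
  congr 1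
  funext o
  cases o <;> rfl

theorem Mat.fill (p : Term L (Option X)) {z₁ z₂ z₃ z₄ : A} {v₁ v₂ v₃ v₄ : X → A}
    (hz : Mat I z₁ z₂ z₃ z₄) (hv : ∀ x, Mat I (v₁ x) (v₂ x) (v₃ x) (v₄ x)) :
    Mat I (fill I p z₁ v₁) (fill I p z₂ v₂) (fill I p z₃ v₃) (fill I p z₄ v₄) :=
  Mat.realize p (by rintro (_ | x); exacts [hz, hv x])

theorem realize_sumElim (t : Term L (K ⊕ M)) (i : K → Term L Y) (j : M → Term L Y) (v : Y → A) :
    (t.subst (Sum.elim i j)).realize I v =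
      t.realize I (Sum.elim (fun k => (i k).realize I v) (fun m => (j m).realize I v)) := by
  rw [Term.realize_subst]
  congr 1
  funext x
  cases x <;> rfl

theorem Mat.realize_sumElim (t : Term L (K ⊕ M)) {a₁ a₂ a₃ a₄ : K → A} {u₁ u₂ u₃ u₄ : M → A}
    (ha : ∀ k, Mat I (a₁ k) (a₂ k) (a₃ k) (a₄ k)) (hu : ∀ m, Mat I (u₁ m) (u₂ m) (u₃ m) (u₄ m)) :
    Mat I (t.realize I (Sum.elim a₁ u₁)) (t.realize I (Sum.elim a₂ u₂))
      (t.realize I (Sum.elim a₃ u₃)) (t.realize I (Sum.elim a₄ u₄)) :=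
  Mat.realize t (by rintro (k | m); exacts [ha k, hu m])

/-- Evaluation of a term whose variables are split into two blocks of the same shape
and parameters. -/
def diffEval (I : Interp L A) (g : Term L ((K ⊕ K) ⊕ W)) (z z' : K → A) (w : W → A) : A :=
  g.realize I (Sum.elim (Sum.elim z z') w)

theorem Mat.diffEval (g : Term L ((K ⊕ K) ⊕ W)) {a₁ a₂ a₃ a₄ b₁ b₂ b₃ b₄ : K → A}
    {w₁ w₂ w₃ w₄ : W → A} (ha : ∀ k, Mat I (a₁ k) (a₂ k) (a₃ k) (a₄ k))
    (hb : ∀ k, Mat I (b₁ k) (b₂ k) (b₃ k) (b₄ k)) (hw : ∀ x, Mat I (w₁ x) (w₂ x) (w₃ x) (w₄ x)) :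
    Mat I (diffEval I g a₁ b₁ w₁) (diffEval I g a₂ b₂ w₂) (diffEval I g a₃ b₃ w₃)
      (diffEval I g a₄ b₄ w₄) :=
  Mat.realize g (by rintro ((k | k) | x); exacts [ha k, hb k, hw x])

theorem realize_subst_diff (g : Term L ((K ⊕ K) ⊕ W)) (i i' : K → Term L Y) (j : W → Term L Y)
    (v : Y → A) : (g.subst (Sum.elim (Sum.elim i i') j)).realize I v =
      diffEval I g (fun k => (i k).realize I v) (fun k => (i' k).realize I v)
        (fun x => (j x).realize I v) := by
  rw [Term.realize_subst, diffEval]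
  congr 1
  funext x
  rcases x with (x | x) | x <;> rfl

/-- The evaluation of two row blocks and two column blocks. -/
def quad (a b : K → A) (u v : M → A) : (K ⊕ K) ⊕ (M ⊕ M) → A :=
  Sum.elim (Sum.elim a b) (Sum.elim u v)

theorem Mat.quad {a₁ a₂ a₃ a₄ b₁ b₂ b₃ b₄ : K → A} {u₁ u₂ u₃ u₄ v₁ v₂ v₃ v₄ : M → A}
    (ha : ∀ k, Mat I (a₁ k) (a₂ k) (a₃ k) (a₄ k)) (hb : ∀ k, Mat I (b₁ k) (b₂ k) (b₃ k) (b₄ k))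
    (hu : ∀ k, Mat I (u₁ k) (u₂ k) (u₃ k) (u₄ k)) (hv : ∀ k, Mat I (v₁ k) (v₂ k) (v₃ k) (v₄ k))
    (x : (K ⊕ K) ⊕ (M ⊕ M)) :
    Mat I (quad a₁ b₁ u₁ v₁ x) (quad a₂ b₂ u₂ v₂ x) (quad a₃ b₃ u₃ v₃ x) (quad a₄ b₄ u₄ v₄ x) := by
  rcases x with (k | k) | (k | k)
  exacts [ha k, hb k, hu k, hv k]

theorem realize_quad (a b : K → Term L Y) (u v : M → Term L Y) (y : Y → A) :
    (fun x => (quad a b u v x).realize I y) =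
      quad (fun k => (a k).realize I y) (fun k => (b k).realize I y)
        (fun m => (u m).realize I y) (fun m => (v m).realize I y) := by
  funext x
  rcases x with (x | x) | (x | x) <;> rfl

theorem IsHom.apply_subst_sumElim {J : Interp L B} {π : Term L X → B}
    (hπ : IsHom (termInterp L X) J π) (t : Term L (K ⊕ M)) (i : K → Term L X) (j : M → Term L X) :
    π (t.subst (Sum.elim i j)) =
      t.realize J (Sum.elim (fun k => π (i k)) (fun m => π (j m))) := by
  rw [Term.subst, Term.realize_hom hπ]
  congr 1
  funext x
  cases x <;> rfl

/-- In a variety of abelian algebras, a term is strongly rectangular as soon as the contexts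
that could relate its values do not distinguish the rows. -/
theorem rectangular_of_context
    (habelian : ∀ (A : Type) (I : Interp L A), InVariety E I → IsAbelian I)
    (t : Term L (K ⊕ M))
    (H : ∀ p : Term L (Option ((K ⊕ K) ⊕ (M ⊕ M))),
      (∀ (A : Type) (I : Interp L A), InVariety E I → ∀ (a a' b : K → A) (u v : M → A),
        fill I p (t.realize I (Sum.elim a u)) (quad a b u v) =
          fill I p (t.realize I (Sum.elim a' u)) (quad a' b u v)) →
      (∀ (A : Type) (I : Interp L A), InVariety E I → ∀ (a b : K → A) (u : M → A),
        fill I p (t.realize I (Sum.elim a u)) (quad a b u u) = t.realize I (Sum.elim b u)) →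
      ∀ (A : Type) (I : Interp L A), InVariety E I → ∀ (a a' b : K → A) (u v : M → A),
        fill I p (t.realize I (Sum.elim a' u)) (quad a b u v) =
          fill I p (t.realize I (Sum.elim a u)) (quad a b u v))
    {J : Interp L B} (hJ : InVariety E J) {a₀ b₀ : K → B} {u₀ v₀ : M → B}
    (h : t.realize J (Sum.elim a₀ v₀) = t.realize J (Sum.elim b₀ u₀)) :
    t.realize J (Sum.elim b₀ u₀) = t.realize J (Sum.elim b₀ v₀) := by
  let O : Set (Term L ((K ⊕ K) ⊕ (M ⊕ M))) := {e |
    (∀ (A : Type) (I : Interp L A), InVariety E I → ∀ (a a' b : K → A) (u v : M → A),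
      e.realize I (quad a b u v) = e.realize I (quad a' b u v)) ∧
    (∀ (A : Type) (I : Interp L A), InVariety E I → ∀ (a b : K → A) (u : M → A),
      e.realize I (quad a b u u) = t.realize I (Sum.elim b u)) ∧
    e.realize J (quad a₀ b₀ u₀ v₀) = t.realize J (Sum.elim b₀ u₀)}
  have hO : ∀ s s' : Term L ((K ⊕ K) ⊕ (M ⊕ M)), Valid E s s' → s ∈ O → s' ∈ O := by
    rintro s s' hs ⟨h₁, h₂, h₃⟩
    refine ⟨fun A I hI a a' b u v => ?_, fun A I hI a b u => ?_, ?_⟩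
    · rw [← hs A I hI, ← hs A I hI]; exact h₁ A I hI a a' b u v
    · rw [← hs A I hI]; exact h₂ A I hI a b u
    · rw [← hs B J hJ]; exact h₃
  obtain ⟨Q, JQ, π, hQ, -, hπ, hker⟩ := exists_syntactic_quotient O hO
  let a : K → Term L ((K ⊕ K) ⊕ (M ⊕ M)) := fun k => .var (.inl (.inl k))
  let b : K → Term L ((K ⊕ K) ⊕ (M ⊕ M)) := fun k => .var (.inl (.inr k))
  let u : M → Term L ((K ⊕ K) ⊕ (M ⊕ M)) := fun k => .var (.inr (.inl k))
  let v : M → Term L ((K ⊕ K) ⊕ (M ⊕ M)) := fun k => .var (.inr (.inr k))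
  have hrow : π (t.subst (Sum.elim a u)) = π (t.subst (Sum.elim a v)) := by
    refine (hker _ _).2 fun p => ?_
    have hindep : ∀ (A : Type) (I : Interp L A), InVariety E I →
        ∀ (a a' b : K → A) (u v : M → A),
        (fill I p (t.realize I (Sum.elim a u)) (quad a b u v) =
          fill I p (t.realize I (Sum.elim a' u)) (quad a' b u v) ↔
        fill I p (t.realize I (Sum.elim a v)) (quad a b u v) =
          fill I p (t.realize I (Sum.elim a' v)) (quad a' b u v)) :=
      fun A I hI a a' b u v => (habelian A I hI).iff (Mat.fill p
        (Mat.realize_sumElim t (fun _ => .col _ _) (fun _ => .row _ _))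
        (Mat.quad (fun _ => .col _ _) (fun _ => .const _) (fun _ => .const _) (fun _ => .const _)))
    have hend : (∀ (A : Type) (I : Interp L A), InVariety E I → ∀ (a a' b : K → A) (u v : M → A),
        fill I p (t.realize I (Sum.elim a u)) (quad a b u v) =
          fill I p (t.realize I (Sum.elim a' u)) (quad a' b u v)) →
        (∀ (A : Type) (I : Interp L A), InVariety E I → ∀ (a b : K → A) (u : M → A),
          fill I p (t.realize I (Sum.elim a u)) (quad a b u u) = t.realize I (Sum.elim b u)) →
        fill J p (t.realize J (Sum.elim a₀ u₀)) (quad a₀ b₀ u₀ v₀) =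
          fill J p (t.realize J (Sum.elim a₀ v₀)) (quad a₀ b₀ u₀ v₀) := by
      intro h₁ h₂
      rw [h]
      exact (H p h₁ h₂ B J hJ a₀ b₀ b₀ u₀ v₀).symm
    have hu : ∀ (A : Type) (I : Interp L A) (a' b' : K → A) (u' v' : M → A),
        (plug p (t.subst (Sum.elim a u))).realize I (quad a' b' u' v') =
          fill I p (t.realize I (Sum.elim a' u')) (quad a' b' u' v') := by
      intro A I a' b' u' v'
      rw [realize_plug_eq_fill, realize_sumElim]; rfl
    have hv : ∀ (A : Type) (I : Interp L A) (a' b' : K → A) (u' v' : M → A),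
        (plug p (t.subst (Sum.elim a v))).realize I (quad a' b' u' v') =
          fill I p (t.realize I (Sum.elim a' v')) (quad a' b' u' v') := by
      intro A I a' b' u' v'
      rw [realize_plug_eq_fill, realize_sumElim]; rfl
    constructor
    · rintro ⟨h₁, h₂, h₃⟩
      simp only [hu] at h₁ h₂ h₃
      refine ⟨fun A I hI a a' b u v => ?_, fun A I hI a b u => ?_, ?_⟩
      · rw [hv, hv]; exact (hindep A I hI a a' b u v).1 (h₁ A I hI a a' b u v)
      · rw [hv]; exact h₂ A I hI a b u
      · rw [hv, ← hend h₁ h₂, h₃]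
    · rintro ⟨h₁, h₂, h₃⟩
      simp only [hv] at h₁ h₂ h₃
      have h₁' := fun A I hI a a' b u v => (hindep A I hI a a' b u v).2 (h₁ A I hI a a' b u v)
      refine ⟨fun A I hI a a' b u v => ?_, fun A I hI a b u => ?_, ?_⟩
      · rw [hu, hu]; exact h₁' A I hI a a' b u v
      · rw [hu]; exact h₂ A I hI a b u
      · rw [hu, hend h₁' h₂, h₃]
  have hrow' : π (t.subst (Sum.elim b u)) = π (t.subst (Sum.elim b v)) := by
    rw [hπ.apply_subst_sumElim, hπ.apply_subst_sumElim] at hrow ⊢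
    exact ((habelian Q JQ hQ).iff (Mat.realize_sumElim t (fun _ => .row _ _)
      (fun _ => .col _ _))).1 hrow
  have hmem : t.subst (Sum.elim b u) ∈ O := by
    refine ⟨fun A I hI a' a'' b' u' v' => ?_, fun A I hI a' b' u' => ?_, ?_⟩ <;>
      simp only [realize_sumElim] <;> rfl
  have hmem' : t.subst (Sum.elim b v) ∈ O := by
    have := ((hker _ _).1 hrow' (.var none)).1
    exact this hmem
  have := hmem'.2.2
  rw [realize_sumElim] at this
  exact this.symm

/-- The identities `g(z, z', w) ≈ w₀` for those terms `g` that satisfy `g(z, z, w) ≈ w₀`. -/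
inductive TranslationIdentity (E : Set (Term L ℕ × Term L ℕ)) :
    ∀ X : Type, Term L X → Term L X → Prop
  | mk {K W : Type} [Countable K] [Countable W] (g : Term L ((K ⊕ K) ⊕ W)) (w₀ : W)
      (h : ∀ (A : Type) (I : Interp L A), InVariety E I → ∀ (z : K → A) (w : W → A),
        diffEval I g z z w = w w₀) :
      TranslationIdentity E _ g (.var (.inr w₀))

/-- The identities `g(z, z', w) ≈ g(z, z, w)` for those terms `g` for which `g(z, z, w)` does
not depend on `z`. -/
inductive DifferenceIdentity (E : Set (Term L ℕ × Term L ℕ)) :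
    ∀ X : Type, Term L X → Term L X → Prop
  | mk {K W : Type} [Countable K] [Countable W] (g : Term L ((K ⊕ K) ⊕ W))
      (h : ∀ (A : Type) (I : Interp L A), InVariety E I → ∀ (z z' : K → A) (w : W → A),
        diffEval I g z z w = diffEval I g z' z' w) :
      DifferenceIdentity E _ g (g.subst (Sum.elim (Sum.elim (fun k => .var (.inl (.inl k)))
        (fun k => .var (.inl (.inl k)))) (fun w => .var (.inr w))))

/-- If the translation identities hold, then terms that can be specialized to a variable are
strongly rectangular. -/
theorem rectangular_of_specialization
    (habelian : ∀ (A : Type) (I : Interp L A), InVariety E I → IsAbelian I)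
    (htrans : ∀ (X : Type) [Countable X] (s t : Term L X), TranslationIdentity E X s t →
      Valid E s t)
    [Countable K] [Countable Y] (t : Term L (K ⊕ M)) (y₀ : Y) (α : K → Term L Y)
    (β : M → Term L Y)
    (hspec : ∀ (A : Type) (I : Interp L A), InVariety E I → ∀ y : Y → A,
      t.realize I (Sum.elim (fun k => (α k).realize I y) (fun m => (β m).realize I y)) = y y₀)
    {J : Interp L B} (hJ : InVariety E J) {a₀ b₀ : K → B} {u₀ v₀ : M → B}
    (h : t.realize J (Sum.elim a₀ v₀) = t.realize J (Sum.elim b₀ u₀)) :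
    t.realize J (Sum.elim b₀ u₀) = t.realize J (Sum.elim b₀ v₀) := by
  refine rectangular_of_context habelian t (fun p _ h₂ A I hI a a' b u v => ?_) hJ h
  let α' : K → Term L ((K ⊕ K) ⊕ Y) := fun k => (α k).relabel .inr
  let β' : M → Term L ((K ⊕ K) ⊕ Y) := fun m => (β m).relabel .inr
  let g : Term L ((K ⊕ K) ⊕ Y) := p.subst (fun o => o.elim
    (t.subst (Sum.elim (fun k => .var (.inl (.inl k))) β'))
    (quad (fun k => .var (.inl (.inr k))) α' β' β'))
  have hg : ∀ (A : Type) (I : Interp L A) (z z' : K → A) (y : Y → A), diffEval I g z z' y =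
      fill I p (t.realize I (Sum.elim z (fun m => (β m).realize I y)))
        (quad z' (fun k => (α k).realize I y) (fun m => (β m).realize I y)
          (fun m => (β m).realize I y)) := by
    intro A I z z' y
    simp only [g, diffEval, realize_subst_option, realize_sumElim, realize_quad, α', β',
      Term.realize_relabel]
    rfl
  have hdiag : ∀ (A : Type) (I : Interp L A), InVariety E I → ∀ (z : K → A) (y : Y → A),
      diffEval I g z z y = y y₀ := by
    intro A I hI z y
    rw [hg, h₂ A I hI, hspec A I hI]
  have hval : ∀ (z z' : K → A) (y : Y → A), diffEval I g z z' y = y y₀ := fun z z' y =>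
    htrans _ _ _ (.mk g y₀ hdiag) A I hI _
  let y : Y → A := fun _ => t.realize I (Sum.elim a u)
  have heq : diffEval I g a' a y = diffEval I g a a y := by rw [hval, hval]
  rw [hg, hg] at heq
  exact ((habelian A I hI).iff (Mat.fill p
    (Mat.realize_sumElim t (fun _ => .col _ _) (fun _ => .row _ _))
    (Mat.quad (fun _ => .const _) (fun _ => .row _ _) (fun _ => .row _ _)
      (fun _ => .row _ _)))).1 heq

/-- If the translation identities hold in a minimal variety of abelian algebras, then so do
the difference identities. -/
theorem valid_of_differenceIdentity
    (hnontrivial : ∃ (A : Type) (I : Interp L A), InVariety E I ∧ ∃ x y : A, x ≠ y)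
    (hminimal : ∀ E' : Set (Term L ℕ × Term L ℕ), E ⊆ E' →
      (∀ (A : Type) (I : Interp L A), InVariety E' I → ∀ x y : A, x = y) ∨
      (∀ (A : Type) (I : Interp L A), InVariety E I → InVariety E' I))
    (habelian : ∀ (A : Type) (I : Interp L A), InVariety E I → IsAbelian I)
    (htrans : ∀ (X : Type) [Countable X] (s t : Term L X), TranslationIdentity E X s t →
      Valid E s t)
    [Countable X] {s t : Term L X} (hst : DifferenceIdentity E X s t) : Valid E s t := by
  let O : Set (Term L Bool) := {e | Valid E e (.var true)}
  obtain ⟨Q, J, π, hJ, hsurj, hπ, hker⟩ := exists_syntactic_quotient O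
    (fun s t h hs A I hI v => (h A I hI v).symm.trans (hs A I hI v))
  have hne : π (.var true) ≠ π (.var false) := by
    intro h
    have hmem : plug (.var none) (Term.var false) ∈ O :=
      ((hker _ _).1 h (.var none)).1 fun _ _ _ _ => rfl
    obtain ⟨A, I, hI, x, y, hxy⟩ := hnontrivial
    exact hxy (hmem A I hI (fun b => cond b y x))
  refine valid_of_nontrivial_model hminimal (DifferenceIdentity E) hJ hne ?_ hst
  rintro _ _ _ ⟨g, hg⟩ v
  rename_i K' W' _ _
  obtain ⟨i, i', j, rfl⟩ : ∃ i i' j, v = fun x => π (Sum.elim (Sum.elim i i') j x) := by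
    choose σ hσ using fun x => hsurj (v x)
    refine ⟨fun k => σ (.inl (.inl k)), fun k => σ (.inl (.inr k)), fun w => σ (.inr w), ?_⟩
    funext x
    rcases x with (x | x) | x <;> exact (hσ _).symm
  rw [← Term.realize_hom hπ, ← Term.realize_hom hπ]
  refine (hker _ _).2 fun p => ?_
  let G : Term L ((K' ⊕ K') ⊕ Bool) := p.subst (fun o => o.elim
    (g.subst (Sum.elim (Sum.elim (fun k => .var (.inl (.inl k))) (fun k => .var (.inl (.inr k))))
      (fun w => (j w).relabel .inr))) (fun y => .var (.inr y)))
  have hG : ∀ (A : Type) (I : Interp L A) (z z' : K' → A) (y : Bool → A), diffEval I G z z' y =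
      fill I p (diffEval I g z z' (fun w => (j w).realize I y)) y := by
    intro A I z z' y
    simp only [G]
    rw [diffEval, realize_subst_option, realize_subst_diff]
    simp only [Term.realize_relabel]
    rfl
  let T : Term L (K' ⊕ (K' ⊕ Bool)) := G.relabel (Equiv.sumAssoc K' K' Bool)
  have hT : ∀ (A : Type) (I : Interp L A) (z z' : K' → A) (y : Bool → A),
      T.realize I (Sum.elim z (Sum.elim z' y)) = diffEval I G z z' y := by
    intro A I z z' y
    rw [Term.realize_relabel, diffEval]
    congr 1
    funext x
    rcases x with (x | x) | x <;> rfl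
  have h₁ : ∀ (A : Type) (I : Interp L A) (y : Bool → A),
      (plug p (g.realize (termInterp L Bool) (Sum.elim (Sum.elim i i') j))).realize I y =
        diffEval I G (fun k => (i k).realize I y) (fun k => (i' k).realize I y) y := by
    intro A I y
    rw [hG, realize_plug_eq_fill]
    congr 1
    exact realize_subst_diff g i i' j y
  have h₂ : ∀ (A : Type) (I : Interp L A) (y : Bool → A),
      (plug p ((g.subst (Sum.elim (Sum.elim (fun k => .var (.inl (.inl k)))
        (fun k => .var (.inl (.inl k)))) (fun w => .var (.inr w)))).realize (termInterp L Bool)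
          (Sum.elim (Sum.elim i i') j))).realize I y =
        diffEval I G (fun k => (i k).realize I y) (fun k => (i k).realize I y) y := by
    intro A I y
    rw [hG, realize_plug_eq_fill]
    congr 1
    rw [Term.realize_hom (isHom_realize I y), realize_subst_diff]
    rfl
  constructor
  · intro h A I hI y
    have hspec : ∀ (A : Type) (I : Interp L A), InVariety E I → ∀ y : Bool → A,
        T.realize I (Sum.elim (fun k => (i k).realize I y)
          (fun m => (Sum.elim i' Term.var m).realize I y)) = y true := by
      intro A I hI y
      have := h A I hI y
      rw [h₁, ← hT] at this
      refine Eq.trans ?_ this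
      congr 2
      funext x
      cases x <;> rfl
    have key := rectangular_of_specialization habelian htrans T true i (Sum.elim i' .var) hspec hI
      (a₀ := fun k => (i' k).realize I y) (b₀ := fun k => (i k).realize I y)
      (u₀ := Sum.elim (fun k => (i k).realize I y) y)
      (v₀ := Sum.elim (fun k => (i' k).realize I y) y)
      (by rw [hT, hT, hG, hG, hg A I hI])
    rw [h₂, ← hT, key, hT, ← h₁]
    exact h A I hI y
  · intro h A I hI y
    have hdiag : ∀ (A : Type) (I : Interp L A), InVariety E I → ∀ (z : K' → A) (y : Bool → A),
        diffEval I G z z y = y true := by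
      intro A I hI z y
      have := h A I hI y
      rw [h₂, hG] at this
      rw [hG, hg A I hI z (fun k => (i k).realize I y)]
      exact this
    rw [h₁]
    exact htrans _ _ _ (.mk G true hdiag) A I hI _

/-- If the difference identities hold in a variety of abelian algebras, then its members are
strongly rectangular. -/
theorem isStronglyRectangular_of_differenceIdentity
    (habelian : ∀ (A : Type) (I : Interp L A), InVariety E I → IsAbelian I)
    (hdiff : ∀ (X : Type) [Countable X] (s t : Term L X), DifferenceIdentity E X s t →
      Valid E s t)
    {J : Interp L B} (hJ : InVariety E J) : IsStronglyRectangular J := by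
  rintro _ _ _ _ ⟨k, l, f, ⟨m, t, c, hf⟩, a, b, u, v, rfl, rfl, rfl, rfl⟩ hqr
  let T : Term L (Fin k ⊕ (Fin l ⊕ Fin m)) := t.relabel (Equiv.sumAssoc _ _ _)
  have hT : ∀ (a : Fin k → B) (u : Fin l → B),
      f (Sum.elim a u) = T.realize J (Sum.elim a (Sum.elim u c)) := by
    intro a u
    rw [hf, Term.realize_relabel]
    congr 1
    funext x
    rcases x with (x | x) | x <;> rfl
  rw [hT, hT] at hqr ⊢
  refine rectangular_of_context habelian T (fun p h₁ _ A I hI a a' b u v => ?_) hJ hqr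
  let g : Term L ((Fin k ⊕ Fin k) ⊕ (Fin k ⊕ ((Fin l ⊕ Fin m) ⊕ (Fin l ⊕ Fin m)))) :=
    p.subst (fun o => o.elim
      (T.subst (Sum.elim (fun i => .var (.inl (.inl i))) (fun i => .var (.inr (.inr (.inl i))))))
      (quad (fun i => .var (.inl (.inr i))) (fun i => .var (.inr (.inl i)))
        (fun i => .var (.inr (.inr (.inl i)))) (fun i => .var (.inr (.inr (.inr i))))))
  have hg : ∀ (A : Type) (I : Interp L A) (a a' b : Fin k → A) (u v : Fin l ⊕ Fin m → A),
      diffEval I g a' a (Sum.elim b (Sum.elim u v)) =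
        fill I p (T.realize I (Sum.elim a' u)) (quad a b u v) := by
    intro A I a a' b u v
    simp only [g]
    rw [diffEval, realize_subst_option, realize_sumElim, realize_quad]
    rfl
  have hindep : ∀ (A : Type) (I : Interp L A), InVariety E I → ∀ (z z' : Fin k → A)
      (w : Fin k ⊕ ((Fin l ⊕ Fin m) ⊕ (Fin l ⊕ Fin m)) → A),
      diffEval I g z z w = diffEval I g z' z' w := by
    intro A I hI z z' w
    obtain ⟨b, u, v, rfl⟩ : ∃ b u v, w = Sum.elim b (Sum.elim u v) :=
      ⟨_, _, _, by rw [Sum.elim_comp_inl_inr (w ∘ Sum.inr), Sum.elim_comp_inl_inr]⟩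
    rw [hg, hg]
    exact h₁ A I hI z z' b u v
  have key := hdiff _ _ _ (.mk g hindep) A I hI
    (Sum.elim (Sum.elim a' a) (Sum.elim b (Sum.elim u v)))
  rw [realize_subst_diff] at key
  rw [← hg, ← hg]
  exact key.trans (hindep A I hI a' a _)

theorem realize_update [DecidableEq X] (τ : X → Term L Y) (x : X) (e : Term L Y) (v : Y → A) :
    (fun x' => (Function.update τ x e x').realize I v) =
      Function.update (fun x' => (τ x').realize I v) x (e.realize I v) := by
  funext x'
  by_cases h : x' = x
  · subst h; simp
  · simp [h]

/-- Translations of abelian algebras are invertible. -/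
theorem IsAbelian.diffEval_update [DecidableEq W] (hI : IsAbelian I) (g : Term L ((K ⊕ K) ⊕ W))
    (w₀ : W) (h : ∀ (z : K → A) (w : W → A), diffEval I g z z w = w w₀) (a b : K → A)
    (w : W → A) :
    diffEval I g a b (Function.update w w₀ (diffEval I g b a w)) = w w₀ := by
  have hmat : ∀ x, Mat I (Function.update w w₀ (diffEval I g a a w) x)
      (Function.update w w₀ (diffEval I g a b w) x) (Function.update w w₀ (diffEval I g b a w) x)
      (Function.update w w₀ (diffEval I g b b w) x) := by
    intro x
    by_cases hx : x = w₀
    · subst hx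
      simp only [Function.update_self]
      exact Mat.diffEval g (fun _ => .row _ _) (fun _ => .col _ _) (fun _ => .const _)
    · simp only [Function.update_of_ne hx]
      exact .const _
  have heq : diffEval I g a b (Function.update w w₀ (diffEval I g a a w)) =
      diffEval I g a a (Function.update w w₀ (diffEval I g a b w)) := by
    rw [h, h, Function.update_eq_self, Function.update_self]
  rw [(hI.iff (Mat.diffEval g (fun _ => .const _) (fun _ => .col _ _) hmat)).1 heq, h, h,
    Function.update_self]

/-- The binary terms of the form `m(c, c', y)`, where `m(z, z, y) ≈ y`. -/
def translates (E : Set (Term L ℕ × Term L ℕ)) : Set (Term L Bool) :=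
  {e | ∃ (K : Type) (_ : Countable K) (m : Term L ((K ⊕ K) ⊕ Bool)) (c c' : K → Term L Bool),
    (∀ (A : Type) (I : Interp L A), InVariety E I → ∀ (z : K → A) (y : Bool → A),
      diffEval I m z z y = y true) ∧
    ∀ (A : Type) (I : Interp L A), InVariety E I → ∀ y : Bool → A, e.realize I y =
      diffEval I m (fun k => (c k).realize I y) (fun k => (c' k).realize I y) y}

theorem var_true_mem_translates : Term.var true ∈ translates E :=
  ⟨Empty, inferInstance, .var (.inr true), Empty.elim, Empty.elim, fun _ _ _ _ _ => rfl,
    fun _ _ _ _ => rfl⟩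

theorem mem_translates_of_valid {s t : Term L Bool} (hst : Valid E s t) (hs : s ∈ translates E) :
    t ∈ translates E := by
  obtain ⟨K, hK, m, c, c', h, he⟩ := hs
  exact ⟨K, hK, m, c, c', h, fun A I hI y => (hst A I hI y).symm.trans (he A I hI y)⟩

theorem plug_subst_mem_translates
    (habelian : ∀ (A : Type) (I : Interp L A), InVariety E I → IsAbelian I)
    [Countable K] (g : Term L ((K ⊕ K) ⊕ W)) (w₀ : W)
    (hg : ∀ (A : Type) (I : Interp L A), InVariety E I → ∀ (z : K → A) (w : W → A),
      diffEval I g z z w = w w₀)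
    (p : Term L (Option Bool)) (i i' : K → Term L Bool) (j : W → Term L Bool)
    (h : plug p (j w₀) ∈ translates E) :
    plug p (g.subst (Sum.elim (Sum.elim i i') j)) ∈ translates E := by
  obtain ⟨N, _, m, c, c', hm, he⟩ := h
  let up : ∀ {Z : Type}, Term L (Z ⊕ Bool) → Bool → Term L (Z ⊕ Bool) := fun e =>
    Function.update (fun y => .var (.inr y)) true e
  let P : Term L (((N ⊕ K) ⊕ (N ⊕ K)) ⊕ Bool) := p.subst (fun o => o.elim
    (g.subst (Sum.elim (Sum.elim (fun k => .var (.inl (.inl (.inr k))))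
      (fun k => .var (.inl (.inr (.inr k))))) (fun w => (j w).relabel .inr)))
    (fun y => .var (.inr y)))
  let R : Term L (((N ⊕ K) ⊕ (N ⊕ K)) ⊕ Bool) := m.subst (Sum.elim (Sum.elim
    (fun k => (c' k).relabel .inr) (fun k => (c k).relabel .inr)) (up P))
  let S : Term L (((N ⊕ K) ⊕ (N ⊕ K)) ⊕ Bool) := m.subst (Sum.elim (Sum.elim
    (fun k => .var (.inl (.inl (.inl k)))) (fun k => .var (.inl (.inr (.inl k))))) (up R))
  have hS : ∀ (A : Type) (I : Interp L A) (a a' : N → A) (z z' : K → A) (y : Bool → A),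
      diffEval I S (Sum.elim a z) (Sum.elim a' z') y =
        diffEval I m a a' (Function.update y true (diffEval I m
          (fun k => (c' k).realize I y) (fun k => (c k).realize I y)
          (Function.update y true (fill I p
            (diffEval I g z z' (fun w => (j w).realize I y)) y)))) := by
    intro A I a a' z z' y
    simp only [S, R, P, up]
    rw [diffEval, realize_subst_diff, realize_update, realize_subst_diff, realize_update,
      realize_subst_option, realize_subst_diff]
    simp only [Term.realize_relabel]
    rfl
  refine ⟨N ⊕ K, inferInstance, S, Sum.elim c i, Sum.elim c' i', ?_, ?_⟩
  · intro A I hI z y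
    obtain ⟨a, z, rfl⟩ : ∃ a z', z = Sum.elim a z' := ⟨_, _, (Sum.elim_comp_inl_inr z).symm⟩
    rw [hS, hm A I hI, Function.update_self, hg A I hI, ← realize_plug_eq_fill, he A I hI]
    exact (habelian A I hI).diffEval_update m true (hm A I hI) _ _ y
  · intro A I hI y
    have hsum : ∀ (r : N → Term L Bool) (s : K → Term L Bool),
        (fun k => (Sum.elim r s k).realize I y) =
          Sum.elim (fun k => (r k).realize I y) (fun k => (s k).realize I y) := by
      intro r s
      funext k
      cases k <;> rfl
    have key := (habelian A I hI).diffEval_update m true (hm A I hI)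
      (fun k => (c k).realize I y) (fun k => (c' k).realize I y) (Function.update y true
        (fill I p (diffEval I g (fun k => (i k).realize I y) (fun k => (i' k).realize I y)
          (fun w => (j w).realize I y)) y))
    rw [Function.update_idem, Function.update_self] at key
    rw [hsum, hsum, hS, key, realize_plug_eq_fill, realize_subst_diff]

theorem plug_mem_translates
    (habelian : ∀ (A : Type) (I : Interp L A), InVariety E I → IsAbelian I)
    [Countable K] (g : Term L ((K ⊕ K) ⊕ W)) (w₀ : W)
    (hg : ∀ (A : Type) (I : Interp L A), InVariety E I → ∀ (z : K → A) (w : W → A),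
      diffEval I g z z w = w w₀)
    (p : Term L (Option Bool)) (i i' : K → Term L Bool) (j : W → Term L Bool)
    (h : plug p (g.subst (Sum.elim (Sum.elim i i') j)) ∈ translates E) :
    plug p (j w₀) ∈ translates E := by
  classical
  refine mem_translates_of_valid (fun A I hI y => ?_)
    (plug_subst_mem_translates habelian g w₀ hg p i' i
      (Function.update j w₀ (g.subst (Sum.elim (Sum.elim i i') j)))
      (by rwa [Function.update_self]))
  rw [realize_plug_eq_fill, realize_plug_eq_fill, realize_subst_diff, realize_update,
    realize_subst_diff, (habelian A I hI).diffEval_update g w₀ (hg A I hI)]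

theorem hasMaltsevPoly_of_mem_translates (hI : InVariety E I) (hab : IsAbelian I)
    (h : Term.var false ∈ translates E) : HasMaltsevPoly I := by
  obtain ⟨K, _, m, c, c', hm, he⟩ := h
  let ρ : Bool → Fin 3 := fun b => cond b 1 0
  let s : Term L (Fin 3) := m.subst (Sum.elim (Sum.elim (fun k => (c k).relabel ρ)
    (fun k => (c' k).relabel ρ)) (fun b => .var (cond b 2 0)))
  have hs : ∀ x : Fin 3 → A, s.realize I x = diffEval I m
      (fun k => (c k).realize I (fun b => x (ρ b))) (fun k => (c' k).realize I (fun b => x (ρ b)))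
      (fun b => x (cond b 2 0)) := by
    intro x
    simp only [s]
    rw [realize_subst_diff]
    simp only [Term.realize_relabel]
    rfl
  refine ⟨s.realize I, ⟨0, s.relabel .inl, Fin.elim0, fun x => ?_⟩, fun x y => ⟨?_, ?_⟩⟩
  · rw [Term.realize_relabel]; rfl
  · refine (hs _).trans ?_
    have hρ : (fun b => ![x, y, y] (cond b 2 0)) = fun b => ![x, y, y] (ρ b) := by
      funext b
      cases b <;> rfl
    rw [hρ, ← he A I hI]
    rfl
  · refine (hs _).trans ?_
    have hρ : (fun b => ![y, y, x] (ρ b)) = fun _ => y := by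
      funext b
      cases b <;> rfl
    rw [hρ]
    have heq : diffEval I m (fun k => (c k).realize I fun _ => y)
        (fun k => (c' k).realize I fun _ => y) (fun _ => y) =
        diffEval I m (fun k => (c k).realize I fun _ => y)
          (fun k => (c k).realize I fun _ => y) (fun _ => y) := by
      rw [← he A I hI, hm A I hI]
      rfl
    rw [(hab.iff (Mat.diffEval m (fun _ => .const _) (fun _ => .col _ _)
      (fun _ => .row _ _))).1 heq, hm A I hI]
    rfl

/-- If `y` is not a translate of `x`, then a minimal variety of abelian algebras satisfies the
translation identities. -/
theorem valid_of_translationIdentity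
    (hminimal : ∀ E' : Set (Term L ℕ × Term L ℕ), E ⊆ E' →
      (∀ (A : Type) (I : Interp L A), InVariety E' I → ∀ x y : A, x = y) ∨
      (∀ (A : Type) (I : Interp L A), InVariety E I → InVariety E' I))
    (habelian : ∀ (A : Type) (I : Interp L A), InVariety E I → IsAbelian I)
    (h : Term.var false ∉ translates E)
    [Countable X] {s t : Term L X} (hst : TranslationIdentity E X s t) : Valid E s t := by
  obtain ⟨Q, J, π, hJ, hsurj, hπ, hker⟩ := exists_syntactic_quotient (translates E)
    (fun s t => mem_translates_of_valid)
  have hne : π (.var true) ≠ π (.var false) := fun heq =>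
    h (((hker _ _).1 heq (.var none)).1 var_true_mem_translates)
  refine valid_of_nontrivial_model hminimal (TranslationIdentity E) hJ hne ?_ hst
  rintro _ _ _ ⟨g, w₀, hg⟩ v
  obtain ⟨i, i', j, rfl⟩ : ∃ i i' j, v = fun x => π (Sum.elim (Sum.elim i i') j x) := by
    choose σ hσ using fun x => hsurj (v x)
    refine ⟨fun k => σ (.inl (.inl k)), fun k => σ (.inl (.inr k)), fun w => σ (.inr w), ?_⟩
    funext x
    rcases x with (x | x) | x <;> exact (hσ _).symm
  rw [← Term.realize_hom hπ, ← Term.realize_hom hπ]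
  exact (hker _ _).2 fun p => ⟨plug_mem_translates habelian g w₀ hg p i i' j,
    plug_subst_mem_translates habelian g w₀ hg p i i' j⟩

end Contexts

/-- If `Mod(E)` is a minimal variety all of whose members are abelian,
then either every member is affine or every member is strongly abelian. -/
theorem statement3 {L : Lang} (E : Set (Term L ℕ × Term L ℕ))
    (hnontrivial : ∃ (A : Type) (I : Interp L A), InVariety E I ∧ ∃ x y : A, x ≠ y)
    (hminimal : ∀ E' : Set (Term L ℕ × Term L ℕ), E ⊆ E' →
      (∀ (A : Type) (I : Interp L A), InVariety E' I → ∀ x y : A, x = y) ∨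
      (∀ (A : Type) (I : Interp L A), InVariety E I → InVariety E' I))
    (habelian : ∀ (A : Type) (I : Interp L A), InVariety E I → IsAbelian I) :
    (∀ (A : Type) (I : Interp L A), InVariety E I → IsAffine I) ∨
    (∀ (A : Type) (I : Interp L A), InVariety E I → IsStronglyAbelian I) := by
  by_cases h : Term.var false ∈ translates E
  · exact .inl fun A I hI =>
      ⟨habelian A I hI, hasMaltsevPoly_of_mem_translates hI (habelian A I hI) h⟩
  · refine .inr fun A I hI =>
      ⟨habelian A I hI, isStronglyRectangular_of_differenceIdentity habelian ?_ hI⟩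
    exact fun X _ s t => valid_of_differenceIdentity hnontrivial hminimal habelian
      fun X _ s t => valid_of_translationIdentity hminimal habelian h

end UA
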